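/- Let (D_x) be a subordinator with Laplace exponent φ and E_t its inverse. Then for every p>0, δ>0, and s>0, ∫₀^∞ e^{−st} E[E_t^p · 1_{{E_t > δ}}] dt = Γ(p+1, δφ(s)) / ( s·[φ(s)]^p ), where Γ(a,z)=∫_z^∞ y^{a−1}e^{−y}dy is the upper incomplete Gamma function. -/

import Mathlib

open MeasureTheory ProbabilityTheory Filter

/-- The upper incomplete Gamma function `Γ(a, z) = ∫_z^∞ y^{a-1} e^{-y} dy`. -/
noncomputable def upperIncompleteGamma (a z : ℝ) : ℝ :=
  ∫ y in Set.Ioi z, y ^ (a - 1) * Real.exp (-y)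

lemma aux_lint_exp {s : ℝ} (hs : 0 < s) (c : ℝ) :
    ∫⁻ t in Set.Ioi c, ENNReal.ofReal (Real.exp (-(s * t))) =
      ENNReal.ofReal (Real.exp (-(s * c)) / s) := by
  have h1 := integral_exp_mul_Ioi (a := -s) (by linarith) c
  have h2 := integrableOn_exp_mul_Ioi (a := -s) (by linarith) c
  simp only [neg_mul] at h1 h2
  rw [← ofReal_integral_eq_lintegral_ofReal h2 (ae_of_all _ fun _ => (Real.exp_pos _).le), h1,
    neg_div_neg_eq]

lemma aux_nonneg {Ω : Type*} [MeasurableSpace Ω] {μ : Measure Ω} [IsProbabilityMeasure μ]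
    {X : Ω → ℝ} (hint : ∀ s > (0 : ℝ), Integrable (fun ω => Real.exp (-(s * X ω))) μ)
    (hle : ∀ s > (0 : ℝ), ∫ ω, Real.exp (-(s * X ω)) ∂μ ≤ 1) : ∀ᵐ ω ∂μ, 0 ≤ X ω := by
  have key : ∀ n : ℕ, ∀ᵐ ω ∂μ, -(1 / ((n : ℝ) + 1)) < X ω := by
    intro n
    set ε : ℝ := 1 / ((n : ℝ) + 1) with hε
    have hεpos : 0 < ε := by positivity
    have hb : ∀ m : ℕ, μ.real {ω | X ω ≤ -ε} ≤ Real.exp (-(ε * ((m : ℝ) + 1))) := by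
      intro m
      have hm : (0 : ℝ) < (m : ℝ) + 1 := by positivity
      have h := mul_meas_ge_le_integral_of_nonneg
        (ae_of_all μ fun ω => (Real.exp_pos (-(((m : ℝ) + 1) * X ω))).le)
        (hint _ hm) (Real.exp (ε * ((m : ℝ) + 1)))
      have h' := h.trans (hle _ hm)
      have hset : {ω | X ω ≤ -ε} =
          {ω | Real.exp (ε * ((m : ℝ) + 1)) ≤ Real.exp (-(((m : ℝ) + 1) * X ω))} := by
        ext ω
        simp only [Set.mem_ofPred_eq, Real.exp_le_exp]
        constructor
        · intro h; nlinarith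
        · intro h; by_contra hc; push Not at hc; nlinarith
      rw [hset, Real.exp_neg, ← one_div, le_div_iff₀ (Real.exp_pos _), mul_comm]
      exact h'
    have ht : Tendsto (fun m : ℕ => Real.exp (-(ε * ((m : ℝ) + 1)))) atTop (nhds 0) := by
      apply Real.tendsto_exp_neg_atTop_nhds_zero.comp
      apply Tendsto.const_mul_atTop hεpos
      exact tendsto_atTop_add_const_right _ _ tendsto_natCast_atTop_atTop
    have h0 : μ.real {ω | X ω ≤ -ε} ≤ 0 := ge_of_tendsto' ht hb
    have h00 : μ.real {ω | X ω ≤ -ε} = 0 := le_antisymm h0 measureReal_nonneg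
    have : μ {ω | X ω ≤ -ε} = 0 := by
      rwa [measureReal_eq_zero_iff] at h00
    rw [ae_iff]
    simpa only [not_lt] using this
  rw [← ae_all_iff] at key
  filter_upwards [key] with ω h
  by_contra hc
  push Not at hc
  obtain ⟨n, hn⟩ := exists_nat_one_div_lt (neg_pos.2 hc)
  have := h n
  linarith

lemma aux_laplace {Ω : Type*} [MeasurableSpace Ω] {μ : Measure Ω} [IsProbabilityMeasure μ]
    {X : Ω → ℝ} (hint : ∀ s > (0 : ℝ), Integrable (fun ω => Real.exp (-(s * X ω))) μ)
    (hle : ∀ s > (0 : ℝ), ∫ ω, Real.exp (-(s * X ω)) ∂μ ≤ 1) {s : ℝ} (hs : 0 < s) :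
    ∫⁻ t in Set.Ioi (0 : ℝ), ENNReal.ofReal (Real.exp (-(s * t))) * μ {ω | X ω < t} =
      ENNReal.ofReal ((∫ ω, Real.exp (-(s * X ω)) ∂μ) / s) := by
  have hX0 := aux_nonneg hint hle
  have hXm : AEMeasurable X μ := by
    have h1 := (hint 1 one_pos).1.aemeasurable
    have h2 := (Real.aemeasurable_of_aemeasurable_exp h1).neg
    convert h2 using 1
    ext ω; simp
  obtain ⟨Y, hYm, hXY⟩ := hXm
  have hm : ∀ t, μ {ω | X ω < t} = ∫⁻ ω, (if Y ω < t then 1 else 0) ∂μ := by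
    intro t
    have : μ {ω | X ω < t} = μ {ω | Y ω < t} := by
      apply measure_congr
      filter_upwards [hXY] with ω h
      simp only [eq_iff_iff]
      change X ω < t ↔ Y ω < t
      rw [h]
    rw [this, ← lintegral_indicator_one (measurableSet_lt hYm measurable_const)]
    rfl
  have hmeas : Measurable (fun q : ℝ × Ω => ENNReal.ofReal (Real.exp (-(s * q.1))) *
      (if Y q.2 < q.1 then (1 : ENNReal) else 0)) := by
    refine Measurable.mul (by fun_prop) ?_
    exact Measurable.ite (measurableSet_lt (by fun_prop) measurable_fst) measurable_const
      measurable_const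
  have h1 : ∀ t, ENNReal.ofReal (Real.exp (-(s * t))) * μ {ω | X ω < t} =
      ∫⁻ ω, ENNReal.ofReal (Real.exp (-(s * t))) * (if Y ω < t then (1 : ENNReal) else 0) ∂μ := by
    intro t
    rw [hm, lintegral_const_mul' _ _ ENNReal.ofReal_ne_top]
  simp_rw [h1]
  rw [lintegral_lintegral_swap hmeas.aemeasurable]
  rw [← integral_div, ofReal_integral_eq_lintegral_ofReal ((hint s hs).div_const _)
    (ae_of_all _ fun _ => by positivity)]
  apply lintegral_congr_ae
  filter_upwards [hXY, hX0] with ω h h0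
  rw [← aux_lint_exp hs, h]
  rw [h] at h0
  rw [← lintegral_indicator measurableSet_Ioi, ← lintegral_indicator measurableSet_Ioi]
  congr 1
  ext t
  simp only [Set.indicator_apply, Set.mem_Ioi]
  by_cases h2 : Y ω < t
  · simp [h2, h0.trans_lt h2]
  · simp [h2]

/-- layer cake for truncated moments -/
lemma aux_layer {α : Type*} [MeasurableSpace α] (μ : Measure α) {f : α → ℝ}
    (hf0 : ∀ a, 0 ≤ f a) (hf : AEMeasurable f μ) {p δ : ℝ} (hp : 0 < p) :
    ∫⁻ a, ENNReal.ofReal (if δ < f a then f a ^ p else 0) ∂μ =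
      ENNReal.ofReal p * ∫⁻ x in Set.Ioi (0 : ℝ),
        μ {a | max δ x < f a} * ENNReal.ofReal (x ^ (p - 1)) := by
  have hg : AEMeasurable (fun a => if δ < f a then f a else 0) μ := by
    have : Measurable (fun y : ℝ => if δ < y then y else 0) :=
      Measurable.ite (measurableSet_lt measurable_const measurable_id) measurable_id
        measurable_const
    exact this.comp_aemeasurable hf
  have h := lintegral_rpow_eq_lintegral_meas_lt_mul μ (f := fun a => if δ < f a then f a else 0)
    (ae_of_all _ fun a => by dsimp; split_ifs; exacts [hf0 a, le_rfl]) hg hp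
  convert h using 1
  · congr 1; ext a; split_ifs
    · rfl
    · rw [Real.zero_rpow hp.ne']
  · congr 1
    apply setLIntegral_congr_fun measurableSet_Ioi
    intro x hx
    dsimp only
    congr 2
    ext a
    simp only [Set.mem_ofPred_eq, max_lt_iff]
    split_ifs with h1
    · simp [h1]
    · simp [h1, (show (0 : ℝ) < x from hx).le]

lemma aux_exp {r p δ : ℝ} (hr : 0 < r) (hp : 0 < p) (hδ : 0 < δ) :
    ENNReal.ofReal p * ∫⁻ x in Set.Ioi (0 : ℝ),
        ENNReal.ofReal (Real.exp (-(max δ x * r))) * ENNReal.ofReal (x ^ (p - 1)) =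
      ENNReal.ofReal (upperIncompleteGamma (p + 1) (δ * r) / r ^ p) := by
  set d : ℝ → ENNReal := fun y => ENNReal.ofReal (r * Real.exp (-(r * y))) with hd
  have hdm : Measurable d := by fun_prop
  set ν : Measure ℝ := (volume.restrict (Set.Ioi 0)).withDensity d with hν
  have hν1 : ∀ c, 0 < c → ν (Set.Ioi c) = ENNReal.ofReal (Real.exp (-(c * r))) := by
    intro c hc
    rw [hν, withDensity_apply _ measurableSet_Ioi, Measure.restrict_restrict measurableSet_Ioi,
      Set.inter_eq_left.2 (Set.Ioi_subset_Ioi hc.le)]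
    simp_rw [hd, ENNReal.ofReal_mul hr.le]
    rw [lintegral_const_mul' _ _ ENNReal.ofReal_ne_top, aux_lint_exp hr,
      ← ENNReal.ofReal_mul hr.le]
    congr 1
    rw [mul_comm c r]; field_simp
  have hl := aux_layer ν (f := fun y => |y|) (fun _ => abs_nonneg _) (by fun_prop) (δ := δ) hp
  have hνpos : ∀ᵐ y ∂ν, 0 < y := by
    apply (withDensity_absolutelyContinuous _ _).ae_le
    exact ae_restrict_mem measurableSet_Ioi
  have hR : ∀ x, ν {a | max δ x < |a|} = ENNReal.ofReal (Real.exp (-(max δ x * r))) := by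
    intro x
    rw [← hν1 _ (lt_max_of_lt_left hδ)]
    apply measure_congr
    filter_upwards [hνpos] with y hy
    simp only [eq_iff_iff]
    change max δ x < |y| ↔ max δ x < y
    rw [abs_of_pos hy]
  simp_rw [hR] at hl
  rw [← hl, hν, lintegral_withDensity_eq_lintegral_mul_non_measurable _ hdm
    (ae_of_all _ fun _ => ENNReal.ofReal_lt_top)]
  have e1 : ∫⁻ a in Set.Ioi (0 : ℝ),
      (d * fun a => ENNReal.ofReal (if δ < |a| then |a| ^ p else 0)) a =
      ∫⁻ a in Set.Ioi δ, ENNReal.ofReal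
        (r * r⁻¹ ^ p * ((r * a) ^ (p + 1 - 1) * Real.exp (-(r * a)))) := by
    rw [← lintegral_indicator measurableSet_Ioi, ← lintegral_indicator measurableSet_Ioi]
    congr 1
    ext a
    simp only [Set.indicator_apply, Set.mem_Ioi, Pi.mul_apply, hd]
    by_cases h : δ < a
    · have ha : 0 < a := hδ.trans h
      simp only [h, ha, abs_of_pos ha, if_true]
      rw [← ENNReal.ofReal_mul (by positivity)]
      congr 1
      rw [add_sub_cancel_right, Real.mul_rpow hr.le ha.le, Real.inv_rpow hr.le]
      have := (Real.rpow_pos_of_pos hr p).ne'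
      field_simp
    · by_cases ha : 0 < a
      · simp [h, abs_of_pos ha]
      · simp [h, ha]
  rw [e1, ← ofReal_integral_eq_lintegral_ofReal]
  · congr 1
    rw [integral_const_mul, integral_comp_mul_left_Ioi
      (fun y => y ^ (p + 1 - 1) * Real.exp (-y)) δ hr, upperIncompleteGamma, mul_comm r δ,
      Real.inv_rpow hr.le, smul_eq_mul]
    have := (Real.rpow_pos_of_pos hr p).ne'
    field_simp
  · apply Integrable.const_mul
    have h := (Real.GammaIntegral_convergent (s := p + 1) (by linarith)).mono_set
      (Set.Ioi_subset_Ioi (mul_pos hr hδ).le)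
    have h2 := (integrableOn_Ioi_comp_mul_left_iff
      (fun y => Real.exp (-y) * y ^ (p + 1 - 1)) δ hr).2 h
    simp only [mul_comm (Real.exp _)] at h2
    exact h2
  · filter_upwards [ae_restrict_mem measurableSet_Ioi] with a ha
    have : 0 < a := hδ.trans ha
    positivity

/-- Laplace transform of truncated moments of an inverse subordinator:
`∫₀^∞ e^{-st} E[E_t^p 1_{E_t > δ}] dt = Γ(p+1, δφ(s))/(s φ(s)^p)`. -/
theorem laplace_transform_inverse_subordinator_truncated_moments
    {Ω : Type*} [MeasureSpace Ω] [IsProbabilityMeasure (ℙ : Measure Ω)]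
    (D E : ℝ → Ω → ℝ) (φ : ℝ → ℝ)
    (hmeasE : ∀ t > (0 : ℝ), Measurable (E t))
    (hEnonneg : ∀ t ω, 0 ≤ E t ω)
    (hφpos : ∀ s > 0, 0 < φ s)
    (hlap : ∀ s > 0, ∀ x ≥ (0 : ℝ),
      ∫ ω, Real.exp (-(s * D x ω)) = Real.exp (-(x * φ s)))
    (hinv : ∀ t > (0 : ℝ), ∀ x > (0 : ℝ),
      ℙ {ω | x < E t ω} = ℙ {ω | D x ω < t}) :
    ∀ p > (0 : ℝ), ∀ δ > (0 : ℝ), ∀ s > (0 : ℝ),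
      ∫ t in Set.Ioi (0 : ℝ), Real.exp (-(s * t)) *
          ∫ ω, (if δ < E t ω then (E t ω) ^ p else 0) =
        upperIncompleteGamma (p + 1) (δ * φ s) / (s * (φ s) ^ p) := by
  intro p hp δ hδ s hs
  have hφ := hφpos s hs
  -- Laplace transform of the tail
  have hA : ∀ x > (0 : ℝ), ∫⁻ t in Set.Ioi (0 : ℝ),
      ENNReal.ofReal (Real.exp (-(s * t))) * ℙ {ω | D x ω < t} =
      ENNReal.ofReal (Real.exp (-(x * φ s)) / s) := by
    intro x hx
    rw [← hlap s hs x hx.le]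
    apply aux_laplace _ _ hs
    · intro u hu
      by_contra hc
      have h1 := hlap u hu x hx.le
      rw [integral_undef hc] at h1
      exact (Real.exp_pos _).ne h1
    · intro u hu
      rw [hlap u hu x hx.le, Real.exp_le_one_iff]
      have := mul_pos hx (hφpos u hu)
      linarith
  -- jointly measurable version of the tail
  let G : ℝ → ℝ → ENNReal := fun t x => ⨆ q : ℚ, if x < (q : ℝ) then ℙ {ω | D q ω < t} else 0
  have hGm : Measurable (Function.uncurry G) := by
    apply Measurable.iSup
    intro q
    refine Measurable.ite (measurableSet_lt measurable_snd measurable_const) ?_ measurable_const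
    have hmono : Monotone (fun t : ℝ => ℙ {ω | D q ω < t}) := by
      intro a b hab
      exact measure_mono fun ω h => lt_of_lt_of_le h hab
    exact hmono.measurable.comp measurable_fst
  have hG : ∀ t > (0 : ℝ), ∀ x > (0 : ℝ), ℙ {ω | x < E t ω} = G t x := by
    intro t ht x hx
    apply le_antisymm
    · have hU : {ω | x < E t ω} = ⋃ q : {q : ℚ // x < (q : ℝ)}, {ω | ((q : ℚ) : ℝ) < E t ω} := by
        ext ω
        simp only [Set.mem_ofPred_eq, Set.mem_iUnion]
        constructor
        · intro h
          obtain ⟨q, h1, h2⟩ := exists_rat_btwn h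
          exact ⟨⟨q, h1⟩, h2⟩
        · rintro ⟨q, h⟩
          exact q.2.trans h
      rw [hU, Directed.measure_iUnion]
      · apply iSup_le
        rintro ⟨q, hq⟩
        rw [hinv t ht q (hx.trans hq)]
        refine le_trans ?_ (le_iSup _ q)
        simp [hq]
      · intro a b
        refine ⟨⟨min a b, ?_⟩, ?_, ?_⟩
        · rw [Rat.cast_min]; exact lt_min a.2 b.2
        · intro ω h
          have h' : (((a : ℚ)) : ℝ) < E t ω := h
          change ((min (a : ℚ) (b : ℚ) : ℚ) : ℝ) < E t ω
          exact lt_of_le_of_lt (Rat.cast_le.2 (min_le_left (a : ℚ) (b : ℚ))) h'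
        · intro ω h
          have h' : (((b : ℚ)) : ℝ) < E t ω := h
          change ((min (a : ℚ) (b : ℚ) : ℚ) : ℝ) < E t ω
          exact lt_of_le_of_lt (Rat.cast_le.2 (min_le_right (a : ℚ) (b : ℚ))) h'
    · apply iSup_le
      intro q
      split_ifs with h
      · rw [← hinv t ht q (hx.trans h)]
        exact measure_mono fun ω h' => h.trans h'
      · exact zero_le
  let K : ℝ → ℝ → ENNReal := fun t x =>
    ENNReal.ofReal (Real.exp (-(s * t))) * (G t (max δ x) * ENNReal.ofReal (x ^ (p - 1)))
  have hKm : Measurable (Function.uncurry K) := by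
    have h1 : Measurable (fun q : ℝ × ℝ => G q.1 (max δ q.2)) :=
      hGm.comp (measurable_fst.prodMk (measurable_const.max measurable_snd))
    refine Measurable.mul (by fun_prop) (h1.mul (by fun_prop))
  let L : ℝ → ENNReal := fun t => ENNReal.ofReal p * ∫⁻ x in Set.Ioi (0 : ℝ), K t x
  have hLm : Measurable L := (Measurable.lintegral_prod_right hKm).const_mul _
  have hLint : ∀ t > (0 : ℝ), Real.exp (-(s * t)) *
      ∫ ω, (if δ < E t ω then (E t ω) ^ p else 0) = (L t).toReal := by
    intro t ht
    have hm : Measurable (fun ω => if δ < E t ω then (E t ω) ^ p else 0) :=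
      Measurable.ite (measurableSet_lt measurable_const (hmeasE t ht))
        ((hmeasE t ht).pow_const _) measurable_const
    rw [integral_eq_lintegral_of_nonneg_ae (ae_of_all _ fun ω => by
        dsimp; split_ifs; exacts [Real.rpow_nonneg (hEnonneg t ω) _, le_rfl])
      hm.aestronglyMeasurable,
      aux_layer ℙ (hEnonneg t) (hmeasE t ht).aemeasurable hp]
    simp only [L, K]
    rw [lintegral_const_mul' _ _ ENNReal.ofReal_ne_top, mul_left_comm, ENNReal.toReal_mul
      (a := ENNReal.ofReal (Real.exp (-(s * t)))), ENNReal.toReal_ofReal (Real.exp_pos _).le]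
    congr 4
    ext x
    rw [hG t ht _ (lt_max_of_lt_left hδ)]
  have hLtot : ∫⁻ t in Set.Ioi (0 : ℝ), L t =
      ENNReal.ofReal (upperIncompleteGamma (p + 1) (δ * φ s) / (s * (φ s) ^ p)) := by
    simp only [L]
    rw [lintegral_const_mul' _ _ ENNReal.ofReal_ne_top,
      lintegral_lintegral_swap hKm.aemeasurable]
    have h1 : ∀ x, ∫⁻ t in Set.Ioi (0 : ℝ), K t x = ENNReal.ofReal s⁻¹ *
        (ENNReal.ofReal (Real.exp (-(max δ x * φ s))) * ENNReal.ofReal (x ^ (p - 1))) := by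
      intro x
      have hx : 0 < max δ x := lt_max_of_lt_left hδ
      simp only [K, ← mul_assoc]
      rw [lintegral_mul_const' _ _ ENNReal.ofReal_ne_top, ← ENNReal.ofReal_mul (by positivity),
        inv_mul_eq_div, ← hA _ hx]
      congr 1
      apply setLIntegral_congr_fun measurableSet_Ioi
      intro t ht
      dsimp only
      rw [← hG t ht _ hx, hinv t ht _ hx]
    simp_rw [h1]
    rw [lintegral_const_mul' _ _ ENNReal.ofReal_ne_top, mul_left_comm, aux_exp hφ hp hδ,
      ← ENNReal.ofReal_mul (by positivity)]
    congr 1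
    field_simp
  rw [setIntegral_congr_fun measurableSet_Ioi (fun t ht => hLint t ht),
    integral_toReal hLm.aemeasurable, hLtot, ENNReal.toReal_ofReal]
  · apply div_nonneg _ (by positivity)
    apply setIntegral_nonneg measurableSet_Ioi
    intro y hy
    have : 0 < y := (mul_pos hδ hφ).trans hy
    positivity
  · apply ae_lt_top hLm
    rw [hLtot]
    exact ENNReal.ofReal_ne_top
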